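/- arXiv:2307.16527 — 2 statements merged into one kernel-verified Lean document; each statement's English description precedes it below -/
import Mathlib

section
/- Localized L¹ estimate for the linear-in-η error term: there exist constants δ₀ > 0, A₀ > 0 and C > 0 such that for every A ≥ A₀, every δ ∈ (0, δ₀), every z ∈ ℂ² with |z| ≤ δ, and every measurable η₁ : ℝ → ℝ, one has ‖ χ(x/A) (f'(Φ[z]₁) - f'(Q)) η₁ ‖_{L¹(ℝ)} ≤ C δ^{p-1} ‖ sech(2x/A) η₁ ‖_{L²(ℝ)}, where f'(u) = p|u|^{p-1}. -/
open Real

/-- The soliton `Q(x) = ((p+1)/2)^{1/(p-1)} (sech(β₀x))^{2/(p-1)}` with `β₀ = (p-1)/2`,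
where `sech t = 1 / cosh t`. -/
noncomputable def solitonQ (p : ℝ) : ℝ → ℝ :=
  fun x => ((p + 1) / 2) ^ (1 / (p - 1)) * ((Real.cosh ((p - 1) / 2 * x))⁻¹) ^ (2 / (p - 1))

/-- The nonlinearity `f(u) = |u|^{p-1} u`. -/
noncomputable def fNL (p : ℝ) : ℝ → ℝ :=
  fun u => |u| ^ (p - 1) * u

/-- The operator `(S_j* g)(x) = -g'(x) - k tanh(β₀x) g(x)` with `β₀ = (p-1)/2`,
for a constant `k`. -/
noncomputable def Sstar (p k : ℝ) (g : ℝ → ℝ) : ℝ → ℝ :=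
  fun x => -(deriv g x) - k * Real.tanh ((p - 1) / 2 * x) * g x

/-- `φ₀ = Q^{k₀}` with `k₀ = (p+1)/2`. -/
noncomputable def phi0 (p : ℝ) : ℝ → ℝ :=
  fun x => solitonQ p x ^ ((p + 1) / 2)

/-- `φ₂ = S₀*(S₁*(Q^{k₂}))` where `k₀ = (p+1)/2`, `k₁ = 1`, `k₂ = (3-p)/2`. -/
noncomputable def phi2 (p : ℝ) : ℝ → ℝ :=
  Sstar p ((p + 1) / 2) (Sstar p 1 (fun x => solitonQ p x ^ ((3 - p) / 2)))

/-- `Φ[z]₁ = Q + Re((1-i)z₁) φ₀ + 2 Re(z₂) φ₂` for `z = (z₁, z₂) ∈ ℂ²`. -/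
noncomputable def PhiZ1 (p : ℝ) (z : ℂ × ℂ) : ℝ → ℝ :=
  fun x => solitonQ p x + ((1 - Complex.I) * z.1).re * phi0 p x + 2 * z.2.re * phi2 p x

theorem abs_abs_rpow_sub_abs_rpow_le {s : ℝ} (hs : 0 ≤ s) (hs1 : s ≤ 1) (a b : ℝ) :
    |(|a| ^ s - |b| ^ s)| ≤ |a - b| ^ s := by
  have key : ∀ u v : ℝ, |u| ^ s ≤ |u - v| ^ s + |v| ^ s := fun u v =>
    calc |u| ^ s ≤ (|u - v| + |v|) ^ s := by
          refine Real.rpow_le_rpow (abs_nonneg u) ?_ hs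
          simpa using abs_add_le (u - v) v
      _ ≤ |u - v| ^ s + |v| ^ s :=
          Real.rpow_add_le_add_rpow (abs_nonneg _) (abs_nonneg _) hs hs1
  have h1 := key a b
  have h2 := key b a
  rw [abs_sub_comm b a] at h2
  rw [abs_le]
  constructor <;> linarith

theorem hasDerivAt_tanh_mul (b x : ℝ) :
    HasDerivAt (fun y => Real.tanh (b * y)) (b * (1 - Real.tanh (b * x) ^ 2)) x := by
  have hc : Real.cosh (b * x) ≠ 0 := (Real.cosh_pos _).ne'
  have hl : HasDerivAt (fun y : ℝ => b * y) b x := by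
    simpa using (hasDerivAt_id x).const_mul b
  have h := hl.sinh.div hl.cosh hc
  have heq : (fun y => Real.tanh (b * y)) = fun y => Real.sinh (b * y) / Real.cosh (b * y) := by
    funext y
    exact Real.tanh_eq_sinh_div_cosh _
  rw [heq]
  refine h.congr_deriv ?_
  rw [Real.tanh_eq_sinh_div_cosh]
  field_simp

theorem hasDerivAt_inv_cosh_rpow (b m x : ℝ) :
    HasDerivAt (fun y => (Real.cosh (b * y))⁻¹ ^ m)
      (-(m * b * Real.tanh (b * x) * (Real.cosh (b * x))⁻¹ ^ m)) x := by
  have hc : 0 < Real.cosh (b * x) := Real.cosh_pos _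
  have hl : HasDerivAt (fun y : ℝ => b * y) b x := by
    simpa using (hasDerivAt_id x).const_mul b
  have h := (hl.cosh.inv hc.ne').rpow_const (p := m) (Or.inl (inv_pos.2 hc).ne')
  refine h.congr_deriv ?_
  simp only [Pi.inv_apply]
  rw [Real.rpow_sub_one (inv_pos.2 hc).ne', Real.tanh_eq_sinh_div_cosh]
  field_simp

theorem inv_cosh_le_one (x : ℝ) : (Real.cosh x)⁻¹ ≤ 1 :=
  inv_le_one_of_one_le₀ (Real.one_le_cosh x)

theorem solitonQ_rpow {p : ℝ} (hp : 0 < p + 1) (k x : ℝ) :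
    solitonQ p x ^ k = (((p + 1) / 2) ^ (1 / (p - 1))) ^ k *
      (Real.cosh ((p - 1) / 2 * x))⁻¹ ^ (2 / (p - 1) * k) := by
  have hc : 0 < (Real.cosh ((p - 1) / 2 * x))⁻¹ := inv_pos.2 (Real.cosh_pos _)
  rw [solitonQ, Real.mul_rpow (Real.rpow_nonneg (by linarith) _) (Real.rpow_nonneg hc.le _),
    ← Real.rpow_mul hc.le]

theorem exists_abs_phi0_le {p : ℝ} (hp : 1 < p) :
    ∃ K ≥ 0, ∀ x, |phi0 p x| ≤ K *
      (Real.cosh ((p - 1) / 2 * x))⁻¹ ^ (2 / (p - 1) * ((3 - p) / 2)) := by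
  have hK : 0 ≤ (((p + 1) / 2) ^ (1 / (p - 1))) ^ ((p + 1) / 2) :=
    Real.rpow_nonneg (Real.rpow_nonneg (by linarith) _) _
  refine ⟨_, hK, fun x => ?_⟩
  have hc : 0 < (Real.cosh ((p - 1) / 2 * x))⁻¹ := inv_pos.2 (Real.cosh_pos _)
  rw [phi0, solitonQ_rpow (by linarith), abs_of_nonneg (mul_nonneg hK (Real.rpow_nonneg hc.le _))]
  refine mul_le_mul_of_nonneg_left ?_ hK
  refine Real.rpow_le_rpow_of_exponent_ge hc (inv_cosh_le_one _) ?_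
  exact mul_le_mul_of_nonneg_left (by linarith) (div_nonneg zero_le_two (by linarith))

theorem Sstar_const_mul_inv_cosh_rpow (p k c m : ℝ) :
    Sstar p k (fun x => c * (Real.cosh ((p - 1) / 2 * x))⁻¹ ^ m) =
      fun x => (m * ((p - 1) / 2) - k) * c * (Real.tanh ((p - 1) / 2 * x) *
        (Real.cosh ((p - 1) / 2 * x))⁻¹ ^ m) := by
  funext x
  rw [Sstar, ((hasDerivAt_inv_cosh_rpow ((p - 1) / 2) m x).const_mul c).deriv]
  ring

theorem Sstar_const_mul_tanh_mul_inv_cosh_rpow (p k c m : ℝ) :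
    Sstar p k (fun x => c * (Real.tanh ((p - 1) / 2 * x) *
        (Real.cosh ((p - 1) / 2 * x))⁻¹ ^ m)) =
      fun x => c * (-((p - 1) / 2) +
        ((p - 1) / 2 + m * ((p - 1) / 2) - k) * Real.tanh ((p - 1) / 2 * x) ^ 2) *
        (Real.cosh ((p - 1) / 2 * x))⁻¹ ^ m := by
  funext x
  have h := ((hasDerivAt_tanh_mul ((p - 1) / 2) x).mul
    (hasDerivAt_inv_cosh_rpow ((p - 1) / 2) m x)).const_mul c
  simp only [Pi.mul_apply] at h
  rw [Sstar, h.deriv]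
  ring

theorem exists_abs_phi2_le {p : ℝ} (hp : 1 < p) :
    ∃ K ≥ 0, ∀ x, |phi2 p x| ≤ K *
      (Real.cosh ((p - 1) / 2 * x))⁻¹ ^ (2 / (p - 1) * ((3 - p) / 2)) := by
  have hQ : (fun x => solitonQ p x ^ ((3 - p) / 2)) = fun x =>
      (((p + 1) / 2) ^ (1 / (p - 1))) ^ ((3 - p) / 2) *
        (Real.cosh ((p - 1) / 2 * x))⁻¹ ^ (2 / (p - 1) * ((3 - p) / 2)) :=
    funext fun x => solitonQ_rpow (by linarith) _ x
  rw [phi2, hQ, Sstar_const_mul_inv_cosh_rpow, Sstar_const_mul_tanh_mul_inv_cosh_rpow]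
  generalize 2 / (p - 1) * ((3 - p) / 2) = m
  generalize (m * ((p - 1) / 2) - 1) * (((p + 1) / 2) ^ (1 / (p - 1))) ^ ((3 - p) / 2) = c
  generalize (p - 1) / 2 + m * ((p - 1) / 2) - (p + 1) / 2 = d
  refine ⟨|c| * (|(p - 1) / 2| + |d|), by positivity, fun x => ?_⟩
  have hc : 0 ≤ (Real.cosh ((p - 1) / 2 * x))⁻¹ := (inv_pos.2 (Real.cosh_pos _)).le
  rw [abs_mul, abs_mul, abs_of_nonneg (Real.rpow_nonneg hc m)]
  gcongr
  refine (abs_add_le _ _).trans ?_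
  rw [abs_neg, abs_mul, abs_of_nonneg (sq_nonneg (Real.tanh _))]
  gcongr
  exact mul_le_of_le_one_right (abs_nonneg d) (Real.tanh_sq_lt_one _).le

theorem exists_abs_PhiZ1_sub_le {p : ℝ} (hp : 1 < p) :
    ∃ K ≥ 0, ∀ δ z, ‖z‖ ≤ δ → ∀ x, |PhiZ1 p z x - solitonQ p x| ≤
      K * δ * (Real.cosh ((p - 1) / 2 * x))⁻¹ ^ (2 / (p - 1) * ((3 - p) / 2)) := by
  obtain ⟨K₀, hK₀, h₀⟩ := exists_abs_phi0_le hp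
  obtain ⟨K₂, hK₂, h₂⟩ := exists_abs_phi2_le hp
  refine ⟨2 * K₀ + 2 * K₂, by positivity, fun δ z hz x => ?_⟩
  have hz1 : ‖z.1‖ ≤ δ := (norm_fst_le z).trans hz
  have hz2 : ‖z.2‖ ≤ δ := (norm_snd_le z).trans hz
  have hδ : 0 ≤ δ := (norm_nonneg z).trans hz
  have ha : |((1 - Complex.I) * z.1).re| ≤ 2 * δ := by
    have h1 := (Complex.abs_re_le_norm z.1).trans hz1
    have h2 := (Complex.abs_im_le_norm z.1).trans hz1
    have h3 : ((1 - Complex.I) * z.1).re = z.1.re + z.1.im := by simp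
    rw [h3]
    exact (abs_add_le _ _).trans (by linarith)
  have hb : |2 * z.2.re| ≤ 2 * δ := by
    rw [abs_mul, abs_two]
    have := (Complex.abs_re_le_norm z.2).trans hz2
    linarith
  have hsub : PhiZ1 p z x - solitonQ p x =
      ((1 - Complex.I) * z.1).re * phi0 p x + 2 * z.2.re * phi2 p x := by
    rw [PhiZ1]
    ring
  rw [hsub]
  calc _ ≤ |((1 - Complex.I) * z.1).re| * |phi0 p x| + |2 * z.2.re| * |phi2 p x| := by
        rw [← abs_mul, ← abs_mul]
        exact abs_add_le _ _
    _ ≤ _ := add_le_add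
        (mul_le_mul ha (h₀ x) (abs_nonneg _) (by positivity))
        (mul_le_mul hb (h₂ x) (abs_nonneg _) (by positivity))
    _ = _ := by ring

theorem exists_abs_PhiZ1_rpow_sub_le {p : ℝ} (hp : 1 < p) (hp2 : p ≤ 2) :
    ∃ K ≥ 0, ∀ δ z, ‖z‖ ≤ δ → ∀ x,
      |p * |PhiZ1 p z x| ^ (p - 1) - p * solitonQ p x ^ (p - 1)| ≤
        K * δ ^ (p - 1) * (Real.cosh ((p - 1) / 2 * x))⁻¹ := by
  obtain ⟨K, hK, h⟩ := exists_abs_PhiZ1_sub_le hp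
  refine ⟨p * K ^ (p - 1), by positivity, fun δ z hz x => ?_⟩
  have hδ : 0 ≤ δ := (norm_nonneg z).trans hz
  have hc : 0 < (Real.cosh ((p - 1) / 2 * x))⁻¹ := inv_pos.2 (Real.cosh_pos _)
  have hQ : 0 ≤ solitonQ p x :=
    mul_nonneg (Real.rpow_nonneg (by linarith) _) (Real.rpow_nonneg hc.le _)
  have hs : 0 ≤ p - 1 := by linarith
  have hexp : 2 / (p - 1) * ((3 - p) / 2) * (p - 1) = 3 - p := by
    have : p - 1 ≠ 0 := by linarith
    field_simp
  calc |p * |PhiZ1 p z x| ^ (p - 1) - p * solitonQ p x ^ (p - 1)|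
      = p * |(|PhiZ1 p z x| ^ (p - 1) - |solitonQ p x| ^ (p - 1))| := by
        rw [← mul_sub, abs_mul, abs_of_nonneg (by linarith : 0 ≤ p), abs_of_nonneg hQ]
    _ ≤ p * |PhiZ1 p z x - solitonQ p x| ^ (p - 1) := by
        gcongr
        exact abs_abs_rpow_sub_abs_rpow_le hs (by linarith) _ _
    _ ≤ p * (K * δ * (Real.cosh ((p - 1) / 2 * x))⁻¹ ^
          (2 / (p - 1) * ((3 - p) / 2))) ^ (p - 1) := by
        gcongr
        exact h δ z hz x
    _ = p * K ^ (p - 1) * δ ^ (p - 1) * (Real.cosh ((p - 1) / 2 * x))⁻¹ ^ (3 - p) := by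
        rw [Real.mul_rpow (by positivity) (Real.rpow_nonneg hc.le _), Real.mul_rpow hK hδ,
          ← Real.rpow_mul hc.le, hexp]
        ring
    _ ≤ _ := by
        gcongr
        simpa using Real.rpow_le_rpow_of_exponent_ge hc (inv_cosh_le_one _)
          (by linarith : (1 : ℝ) ≤ 3 - p)

open MeasureTheory in
theorem memLp_two_inv_cosh_mul {b : ℝ} (hb : b ≠ 0) :
    MemLp (fun x => (Real.cosh (b * x))⁻¹) 2 volume := by
  have hcont : Continuous fun x => (Real.cosh (b * x))⁻¹ :=
    (Real.continuous_cosh.comp (continuous_const.mul continuous_id)).inv₀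
      fun x => (Real.cosh_pos _).ne'
  rw [memLp_two_iff_integrable_sq hcont.aestronglyMeasurable]
  refine (integrable_inv_one_add_sq.comp_mul_left' hb).mono'
    (hcont.pow 2).aestronglyMeasurable (Filter.Eventually.of_forall fun x => ?_)
  rw [Real.norm_of_nonneg (sq_nonneg _), inv_pow, Real.cosh_sq']
  gcongr 1
  have h : |b * x| ≤ |Real.sinh (b * x)| := by
    rw [Real.abs_sinh]
    exact Real.self_le_sinh_iff.2 (abs_nonneg _)
  have := sq_le_sq.2 h
  linarith

open MeasureTheory in
theorem stmt14 (p : ℝ) (hp1 : 5 / 3 < p) (hp2 : p ≤ 2)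
    (χ : ℝ → ℝ) (hχ : ContDiff ℝ (⊤ : ℕ∞) χ) (hχc : HasCompactSupport χ)
    (hχ01 : ∀ x, χ x ∈ Set.Icc (0 : ℝ) 1)
    (hχ1 : ∀ x ∈ Set.Icc (-1 : ℝ) 1, χ x = 1)
    (hχ0 : ∀ x : ℝ, 2 < |x| → χ x = 0)
    (hχeven : ∀ x : ℝ, χ (-x) = χ x) :
    ∃ δ₀ > (0 : ℝ), ∃ A₀ > (0 : ℝ), ∃ C > (0 : ℝ), ∀ A : ℝ, A₀ ≤ A →
      ∀ δ : ℝ, 0 < δ → δ < δ₀ → ∀ z : ℂ × ℂ, ‖z‖ ≤ δ →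
        ∀ η₁ : ℝ → ℝ, Measurable η₁ →
          eLpNorm
              (fun x => χ (x / A) *
                ((p * |PhiZ1 p z x| ^ (p - 1) - p * solitonQ p x ^ (p - 1)) * η₁ x)) 1 volume
            ≤ ENNReal.ofReal (C * δ ^ (p - 1)) *
                eLpNorm (fun x => (Real.cosh (2 * x / A))⁻¹ * η₁ x) 2 volume := by
  obtain ⟨K, hK, hbound⟩ := exists_abs_PhiZ1_rpow_sub_le (by linarith : 1 < p) hp2
  have hg := memLp_two_inv_cosh_mul (by linarith : (p - 1) / 2 ≠ 0)
  set g : ℝ → ℝ := fun x => (Real.cosh ((p - 1) / 2 * x))⁻¹ with hg_def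
  set N : ℝ := (eLpNorm g 2 volume).toReal with hN
  have hN0 : 0 ≤ N := ENNReal.toReal_nonneg
  refine ⟨1, one_pos, 1, one_pos, K * Real.cosh 4 * N + 1, by positivity, ?_⟩
  intro A hA δ hδ _ z hz η hη
  have hA0 : 0 < A := by linarith
  set w : ℝ → ℝ := fun x => (Real.cosh (2 * x / A))⁻¹ * η x with hw_def
  have hw : AEStronglyMeasurable w volume := by
    refine Measurable.aestronglyMeasurable ?_
    exact (Real.measurable_cosh.comp (by fun_prop)).inv.mul hη
  have hD : 0 ≤ K * δ ^ (p - 1) * Real.cosh 4 := by positivity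
  have hpt : ∀ x, ‖χ (x / A) *
      ((p * |PhiZ1 p z x| ^ (p - 1) - p * solitonQ p x ^ (p - 1)) * η x)‖ ≤
        K * δ ^ (p - 1) * Real.cosh 4 * ‖(g • w) x‖ := by
    intro x
    by_cases hx : 2 < |x / A|
    · rw [hχ0 _ hx, zero_mul, norm_zero]
      positivity
    have hcosh : Real.cosh (2 * x / A) ≤ Real.cosh 4 := by
      rw [Real.cosh_le_cosh, mul_div_assoc, abs_mul, abs_two, abs_of_pos (four_pos : (0 : ℝ) < 4)]
      linarith
    have hη' : |η x| ≤ Real.cosh 4 * |w x| := by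
      have hc := Real.cosh_pos (2 * x / A)
      have hηw : η x = Real.cosh (2 * x / A) * w x := by
        rw [hw_def]
        field_simp
      rw [hηw, abs_mul, abs_of_pos hc]
      gcongr
    have hg0 : 0 ≤ g x := (inv_pos.2 (Real.cosh_pos _)).le
    calc _ = |χ (x / A)| * (|p * |PhiZ1 p z x| ^ (p - 1) - p * solitonQ p x ^ (p - 1)| * |η x|) := by
          rw [Real.norm_eq_abs, abs_mul, abs_mul]
      _ ≤ 1 * (K * δ ^ (p - 1) * g x * (Real.cosh 4 * |w x|)) := by
          gcongr
          · rw [abs_of_nonneg (hχ01 _).1]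
            exact (hχ01 _).2
          · exact hbound δ z hz x
      _ = _ := by
          rw [Pi.smul_apply', smul_eq_mul, Real.norm_eq_abs, abs_mul (g x), abs_of_nonneg hg0]
          ring
  calc _ ≤ ENNReal.ofReal (K * δ ^ (p - 1) * Real.cosh 4) * eLpNorm (g • w) 1 volume :=
        eLpNorm_le_mul_eLpNorm_of_ae_le_mul (Filter.Eventually.of_forall hpt) 1
    _ ≤ ENNReal.ofReal (K * δ ^ (p - 1) * Real.cosh 4) *
          (eLpNorm g 2 volume * eLpNorm w 2 volume) := by
        gcongr
        exact eLpNorm_smul_le_mul_eLpNorm hw hg.1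
    _ = ENNReal.ofReal (K * δ ^ (p - 1) * Real.cosh 4 * N) * eLpNorm w 2 volume := by
        rw [ENNReal.ofReal_mul hD, hN, ENNReal.ofReal_toReal hg.eLpNorm_ne_top,
          mul_assoc (ENNReal.ofReal _)]
    _ ≤ _ := by
        gcongr ENNReal.ofReal ?_ * _
        have : 0 ≤ δ ^ (p - 1) := by positivity
        linarith
end

section
/- Weighted L² estimate for the quadratic-in-η error term: there exist constants δ₀ > 0 and C > 0 such that for every κ > 0, every δ ∈ (0, δ₀), every z ∈ ℂ² with |z| ≤ δ, and every measurable η₁ : ℝ → ℝ with ‖η₁‖_{L^∞(ℝ)} ≤ δ, one has ‖ sech(κx) ( f(Φ[z]₁ + η₁) - f(Φ[z]₁) - p|Φ[z]₁|^{p-1} η₁ ) ‖_{L²(ℝ)} ≤ C δ^{p-1} ‖ sech(κx) η₁ ‖_{L²(ℝ)}. -/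
open Real

theorem abs_rpow_sub_rpow_le {s : ℝ} (hs0 : 0 ≤ s) (hs1 : s ≤ 1) {x y : ℝ} (hx : 0 ≤ x)
    (hy : 0 ≤ y) : |x ^ s - y ^ s| ≤ |x - y| ^ s := by
  wlog hxy : y ≤ x generalizing x y
  · rw [abs_sub_comm, abs_sub_comm x y]
    exact this hy hx (le_of_not_ge hxy)
  have hle : y ^ s ≤ x ^ s := Real.rpow_le_rpow hy hxy hs0
  rw [abs_of_nonneg (sub_nonneg.2 hle), abs_of_nonneg (sub_nonneg.2 hxy)]
  have h := Real.rpow_add_le_add_rpow (sub_nonneg.2 hxy) hy hs0 hs1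
  rw [sub_add_cancel] at h
  linarith

theorem hasDerivAt_fNL {p : ℝ} (hp : 1 < p) (x : ℝ) :
    HasDerivAt (fNL p) (p * |x| ^ (p - 1)) x := by
  have hs : 0 < p - 1 := by linarith
  rcases eq_or_ne x 0 with rfl | hx
  · rw [abs_zero, Real.zero_rpow hs.ne', mul_zero, hasDerivAt_iff_tendsto_slope_zero]
    have hlim : Filter.Tendsto (fun t : ℝ => |t| ^ (p - 1)) (nhdsWithin 0 {0}ᶜ) (nhds 0) := by
      have hc : Continuous fun t : ℝ => |t| ^ (p - 1) :=
        continuous_abs.rpow_const fun _ => Or.inr hs.le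
      have h := hc.tendsto 0
      rw [abs_zero, Real.zero_rpow hs.ne'] at h
      exact h.mono_left nhdsWithin_le_nhds
    refine hlim.congr' ?_
    filter_upwards [self_mem_nhdsWithin] with t ht
    have ht : t ≠ 0 := ht
    simp only [fNL, zero_add, mul_zero, sub_zero, smul_eq_mul]
    field_simp
  · have hx' : |x| ≠ 0 := abs_ne_zero.2 hx
    have h := ((hasDerivAt_abs hx).rpow_const (p := p - 1) (Or.inl hx')).mul (hasDerivAt_id x)
    refine h.congr_deriv ?_
    have hpow : |x| ^ (p - 1) = |x| ^ (p - 1 - 1) * |x| := by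
      rw [← Real.rpow_add_one hx', sub_add_cancel]
    have hsign : (SignType.sign x : ℝ) * x = |x| := sign_mul_self x
    simp only [id_eq, mul_one]
    linear_combination (p - 1) * |x| ^ (p - 1 - 1) * hsign - (p - 1) * hpow

theorem abs_fNL_add_sub_sub_le {p : ℝ} (hp1 : 1 < p) (hp2 : p ≤ 2) (a h : ℝ) :
    |fNL p (a + h) - fNL p a - p * |a| ^ (p - 1) * h| ≤ p * |h| ^ (p - 1) * |h| := by
  have hderiv : ∀ t ∈ Set.uIcc a (a + h),
      HasDerivWithinAt (fun u => fNL p u - p * |a| ^ (p - 1) * u)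
        (p * |t| ^ (p - 1) - p * |a| ^ (p - 1)) (Set.uIcc a (a + h)) t := fun t _ =>
    ((hasDerivAt_fNL hp1 t).sub (hasDerivAt_const_mul _)).hasDerivWithinAt
  have hbound : ∀ t ∈ Set.uIcc a (a + h),
      ‖p * |t| ^ (p - 1) - p * |a| ^ (p - 1)‖ ≤ p * |h| ^ (p - 1) := by
    intro t ht
    have hta : |t - a| ≤ |h| := by simpa using Set.abs_sub_left_of_mem_uIcc ht
    rw [← mul_sub, Real.norm_eq_abs, abs_mul, abs_of_pos (zero_lt_one.trans hp1)]
    gcongr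
    calc |(|t| ^ (p - 1) - |a| ^ (p - 1))| ≤ |(|t| - |a|)| ^ (p - 1) :=
          abs_rpow_sub_rpow_le (by linarith) (by linarith) (abs_nonneg t) (abs_nonneg a)
      _ ≤ |h| ^ (p - 1) := Real.rpow_le_rpow (abs_nonneg _)
          ((abs_abs_sub_abs_le t a).trans hta) (by linarith)
  have key := (convex_uIcc a (a + h)).norm_image_sub_le_of_norm_hasDerivWithin_le
    hderiv hbound Set.left_mem_uIcc Set.right_mem_uIcc
  rw [add_sub_cancel_left, Real.norm_eq_abs, Real.norm_eq_abs] at key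
  convert key using 2
  ring


open MeasureTheory in
theorem stmt15 (p : ℝ) (hp1 : 5 / 3 < p) (hp2 : p ≤ 2) :
    ∃ δ₀ > (0 : ℝ), ∃ C > (0 : ℝ), ∀ κ : ℝ, 0 < κ → ∀ δ : ℝ, 0 < δ → δ < δ₀ →
      ∀ z : ℂ × ℂ, ‖z‖ ≤ δ → ∀ η₁ : ℝ → ℝ, Measurable η₁ →
        eLpNorm η₁ ⊤ volume ≤ ENNReal.ofReal δ →
          eLpNorm
              (fun x => (Real.cosh (κ * x))⁻¹ *
                (fNL p (PhiZ1 p z x + η₁ x) - fNL p (PhiZ1 p z x)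
                  - p * |PhiZ1 p z x| ^ (p - 1) * η₁ x)) 2 volume
            ≤ ENNReal.ofReal (C * δ ^ (p - 1)) *
                eLpNorm (fun x => (Real.cosh (κ * x))⁻¹ * η₁ x) 2 volume := by
  refine ⟨1, one_pos, p, by linarith, fun κ _ δ hδ _ z _ η₁ _ hη => ?_⟩
  have hae : ∀ᵐ x, |η₁ x| ≤ δ := by
    filter_upwards [ae_le_eLpNormEssSup (f := η₁) (μ := volume)] with x hx
    rw [← eLpNorm_exponent_top] at hx
    have h := hx.trans hη
    rwa [← ofReal_norm, ENNReal.ofReal_le_ofReal_iff hδ.le] at h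
  refine eLpNorm_le_mul_eLpNorm_of_ae_le_mul ?_ 2
  filter_upwards [hae] with x hx
  rw [norm_mul, norm_mul, mul_left_comm]
  gcongr
  calc _ ≤ p * |η₁ x| ^ (p - 1) * |η₁ x| :=
        abs_fNL_add_sub_sub_le (by linarith) hp2 (PhiZ1 p z x) (η₁ x)
    _ ≤ p * δ ^ (p - 1) * ‖η₁ x‖ := by
      rw [Real.norm_eq_abs]
      have := Real.rpow_le_rpow (abs_nonneg _) hx (by linarith : 0 ≤ p - 1)
      gcongr
end
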